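/- Let p, r ≥ 1, let μ_β ∈ ℝ^p, μ_α ∈ ℝ^r, let Σ_β and Σ_α be symmetric positive definite matrices of sizes p×p and r×r, let W̃ be a real r×p matrix, let ν > r − 1 be real, and let S be a symmetric positive definite r×r matrix. Then ∫ ∫_{ℝ^r} ∫_{ℝ^p} φ_p(β; μ_β, Σ_β) · φ_r(a; μ_α, Σ_α) · p_IW(D; ν, S) · log φ_r(a; W̃β, D) dβ da dD = −(r/2)·log(2π) − (1/2)·[ log det S − ∑_{l=1}^r ψ((ν − l + 1)/2) − r·log 2 ] − (ν/2)·[ (μ_α − W̃μ_β)ᵀ S^{−1} (μ_α − W̃μ_β) + tr( S^{−1} ( Σ_α + W̃ Σ_β W̃ᵀ ) ) ], where the outer integral in D is over the cone of symmetric positive definite r×r matrices with respect to Lebesgue measure on the r(r+1)/2 on-and-below-diagonal entries of D, and ψ = (log Γ)′ is the digamma function. -/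

import Mathlib

open MeasureTheory Matrix Real Finset

/-- The digamma function `ψ = (log Γ)′`. -/
noncomputable def digamma (x : ℝ) : ℝ := deriv (fun y => Real.log (Real.Gamma y)) x

/-- The multivariate gamma function `Γ_r(a) = π^{r(r-1)/4} ∏_{l=1}^r Γ(a + (1-l)/2)`. -/
noncomputable def multivariateGamma (r : ℕ) (a : ℝ) : ℝ :=
  Real.pi ^ ((r : ℝ) * ((r : ℝ) - 1) / 4) *
    ∏ l ∈ Finset.Icc 1 r, Real.Gamma (a + (1 - (l : ℝ)) / 2)

/-- The inverse Wishart density `p_IW(D; ν, S)` on the cone of symmetric positive definite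
`r×r` matrices (w.r.t. Lebesgue measure on the on-and-below-diagonal entries):
`det(S)^{ν/2} 2^{-νr/2} Γ_r(ν/2)⁻¹ det(D)^{-(ν+r+1)/2} exp(-(1/2) tr(S D⁻¹))`. -/
noncomputable def invWishartDensity (r : ℕ) (ν : ℝ) (S D : Matrix (Fin r) (Fin r) ℝ) : ℝ :=
  S.det ^ (ν / 2) * (2 : ℝ) ^ (-(ν * (r : ℝ)) / 2) / multivariateGamma r (ν / 2) *
    D.det ^ (-(ν + (r : ℝ) + 1) / 2) * Real.exp (-(1 / 2) * (S * D⁻¹).trace)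

/-- The symmetric matrix built from a vector of on-and-below-diagonal entries. -/
noncomputable def lowerToSym {r : ℕ} (v : {q : Fin r × Fin r // q.2 ≤ q.1} → ℝ) :
    Matrix (Fin r) (Fin r) ℝ :=
  Matrix.of fun k m => if h : m ≤ k then v ⟨(k, m), h⟩ else v ⟨(m, k), (not_le.mp h).le⟩

/-- Integral of a function `f` over the cone of symmetric positive definite `r×r` matrices,
with respect to Lebesgue measure on the `r(r+1)/2` on-and-below-diagonal entries. -/
noncomputable def spdIntegral (r : ℕ) (f : Matrix (Fin r) (Fin r) ℝ → ℝ) : ℝ :=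
  ∫ v : {q : Fin r × Fin r // q.2 ≤ q.1} → ℝ,
    Set.indicator {w : {q : Fin r × Fin r // q.2 ≤ q.1} → ℝ | (lowerToSym w).PosDef}
      (fun w => f (lowerToSym w)) v


/-- The multivariate Gaussian density `φ_p(x; μ, Σ)` on `ℝ^p` (w.r.t. Lebesgue measure). -/
noncomputable def gaussDensity {p : ℕ} (μ : Fin p → ℝ) (C : Matrix (Fin p) (Fin p) ℝ)
    (x : Fin p → ℝ) : ℝ :=
  (2 * Real.pi) ^ (-(p : ℝ) / 2) * C.det ^ (-(1 : ℝ) / 2) *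
    Real.exp (-(1 / 2) * ((x - μ) ⬝ᵥ (C⁻¹ *ᵥ (x - μ))))

/-! ### Gaussian moments -/

lemma Matrix.PosDef.exists_eq_mul_transpose {n : ℕ} {C : Matrix (Fin n) (Fin n) ℝ}
    (hC : C.PosDef) : ∃ L : Matrix (Fin n) (Fin n) ℝ, C = L * Lᵀ ∧ L.det ≠ 0 := by
  open scoped MatrixOrder in
  obtain ⟨B, hB⟩ := CStarAlgebra.nonneg_iff_eq_star_mul_self.mp hC.posSemidef.nonneg
  have hB' : C = Bᵀ * Bᵀᵀ := by
    simpa [star_eq_conjTranspose, conjTranspose_eq_transpose_of_trivial] using hB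
  refine ⟨Bᵀ, hB', fun h => hC.det_pos.ne' ?_⟩
  rw [hB', det_mul, h, zero_mul]

lemma integral_comp_mulVec {n : ℕ} {L : Matrix (Fin n) (Fin n) ℝ} (hL : L.det ≠ 0)
    (f : (Fin n → ℝ) → ℝ) :
    ∫ x, f x = |L.det| * ∫ z, f (L *ᵥ z) := by
  have hinj : Function.Injective (toLin' L) := by
    intro x y hxy
    exact mulVec_injective_iff_isUnit.2 ((isUnit_iff_isUnit_det _).2 hL.isUnit) hxy
  have hemb : MeasurableEmbedding (toLin' L) :=
    (LinearMap.continuous_of_finiteDimensional _).measurableEmbedding hinj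
  have h := hemb.integral_map (μ := volume) f
  rw [Real.map_matrix_volume_pi_eq_smul_volume_pi hL, integral_smul_measure,
    ENNReal.toReal_ofReal (abs_nonneg _)] at h
  simp only [toLin'_apply, smul_eq_mul] at h
  rw [← h, ← mul_assoc, ← abs_mul, mul_inv_cancel₀ hL, abs_one, one_mul]

lemma lintegral_comp_mulVec {n : ℕ} {L : Matrix (Fin n) (Fin n) ℝ} (hL : L.det ≠ 0)
    (f : (Fin n → ℝ) → ENNReal) :
    ∫⁻ x, f x = ENNReal.ofReal |L.det| * ∫⁻ z, f (L *ᵥ z) := by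
  have hinj : Function.Injective (toLin' L) := by
    intro x y hxy
    exact mulVec_injective_iff_isUnit.2 ((isUnit_iff_isUnit_det _).2 hL.isUnit) hxy
  have hemb : MeasurableEmbedding (toLin' L) :=
    (LinearMap.continuous_of_finiteDimensional _).measurableEmbedding hinj
  have h := hemb.lintegral_map (μ := volume) f
  rw [Real.map_matrix_volume_pi_eq_smul_volume_pi hL, lintegral_smul_measure] at h
  simp only [toLin'_apply, smul_eq_mul] at h
  rw [← h, ← mul_assoc, ← ENNReal.ofReal_mul (abs_nonneg _), ← abs_mul, mul_inv_cancel₀ hL,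
    abs_one, ENNReal.ofReal_one, one_mul]

/-- The standard Gaussian density on `ℝⁿ`, in product form. -/
noncomputable def stdGaussDensity {n : ℕ} (z : Fin n → ℝ) : ℝ :=
  ∏ k, ProbabilityTheory.gaussianPDFReal 0 1 (z k)

lemma gaussDensity_add_mulVec {n : ℕ} (μ : Fin n → ℝ) {L : Matrix (Fin n) (Fin n) ℝ}
    (hL : L.det ≠ 0) (z : Fin n → ℝ) :
    |L.det| * gaussDensity μ (L * Lᵀ) (L *ᵥ z + μ) = stdGaussDensity z := by
  have hu : IsUnit L.det := hL.isUnit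
  have hut : IsUnit Lᵀ.det := by rwa [det_transpose]
  have hquad : (L *ᵥ z) ⬝ᵥ ((L * Lᵀ)⁻¹ *ᵥ (L *ᵥ z)) = z ⬝ᵥ z := by
    rw [Matrix.mul_inv_rev, mulVec_mulVec, Matrix.mul_assoc, nonsing_inv_mul _ hu, Matrix.mul_one,
      ← vecMul_transpose, ← dotProduct_mulVec, mulVec_mulVec, mul_nonsing_inv _ hut, one_mulVec]
  have hdet : (L * Lᵀ).det ^ (-(1 : ℝ) / 2) = |L.det|⁻¹ := by
    rw [det_mul, det_transpose, ← abs_mul_abs_self, ← sq, ← Real.rpow_natCast,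
      ← Real.rpow_mul (abs_nonneg _)]
    norm_num [Real.rpow_neg_one]
  have hpi : (2 * Real.pi) ^ (-(n : ℝ) / 2) = ∏ _k : Fin n, (√(2 * Real.pi))⁻¹ := by
    rw [Finset.prod_const, Finset.card_univ, Fintype.card_fin, Real.sqrt_eq_rpow,
      ← Real.rpow_neg (by positivity), ← Real.rpow_natCast, ← Real.rpow_mul (by positivity)]
    congr 1; ring
  simp only [gaussDensity, stdGaussDensity, ProbabilityTheory.gaussianPDFReal, add_sub_cancel_right]
  rw [hquad, hdet, hpi, Finset.prod_mul_distrib, ← Real.exp_sum]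
  have : |L.det| ≠ 0 := abs_ne_zero.2 hL
  simp only [NNReal.coe_one, mul_one, sub_zero, dotProduct, Finset.mul_sum]
  field_simp

lemma integral_gaussDensity_mul {n : ℕ} (μ : Fin n → ℝ) {L : Matrix (Fin n) (Fin n) ℝ}
    (hL : L.det ≠ 0) (f : (Fin n → ℝ) → ℝ) :
    ∫ x, gaussDensity μ (L * Lᵀ) x * f x = ∫ z, stdGaussDensity z * f (L *ᵥ z + μ) := by
  rw [← integral_add_right_eq_self _ μ, integral_comp_mulVec hL, ← integral_const_mul]
  simp_rw [← gaussDensity_add_mulVec μ hL, mul_assoc]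

lemma stdGaussDensity_mul_apply {n : ℕ} (i : Fin n) (z : Fin n → ℝ) :
    stdGaussDensity z * z i =
      ∏ k, ProbabilityTheory.gaussianPDFReal 0 1 (z k) * (if k = i then z k else 1) := by
  rw [Finset.prod_mul_distrib, Finset.prod_ite_eq' Finset.univ i (fun k => z k)]
  simp [stdGaussDensity]

lemma stdGaussDensity_mul_apply_mul_apply {n : ℕ} (i j : Fin n) (z : Fin n → ℝ) :
    stdGaussDensity z * (z i * z j) =
      ∏ k, ProbabilityTheory.gaussianPDFReal 0 1 (z k) *
        ((if k = i then z k else 1) * (if k = j then z k else 1)) := by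
  rw [Finset.prod_mul_distrib, Finset.prod_mul_distrib,
    Finset.prod_ite_eq' Finset.univ i (fun k => z k),
    Finset.prod_ite_eq' Finset.univ j (fun k => z k)]
  simp [stdGaussDensity]

lemma integrable_gaussianPDFReal_mul_pow (k : ℕ) :
    Integrable (fun x => ProbabilityTheory.gaussianPDFReal 0 1 x * x ^ k) := by
  have h : Integrable (fun x : ℝ => x ^ k) (ProbabilityTheory.gaussianReal 0 1) := by
    have := (ProbabilityTheory.memLp_id_gaussianReal (μ := 0) (v := 1) (k : NNReal))
    rcases k.eq_zero_or_pos with rfl | hk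
    · simp
    · refine (integrable_norm_iff (by fun_prop)).1 ?_
      simpa [norm_pow] using this.integrable_norm_pow hk.ne'
  rw [ProbabilityTheory.gaussianReal_of_var_ne_zero _ one_ne_zero,
    integrable_withDensity_iff_integrable_smul' (ProbabilityTheory.measurable_gaussianPDF _ _)
      (Filter.Eventually.of_forall fun _ => ProbabilityTheory.gaussianPDF_lt_top)] at h
  simpa [ProbabilityTheory.toReal_gaussianPDF] using h

lemma integral_gaussianPDFReal_mul_self :
    ∫ x, ProbabilityTheory.gaussianPDFReal 0 1 x * x = 0 := by
  have h := ProbabilityTheory.integral_gaussianReal_eq_integral_smul (μ := 0) (v := 1)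
    (f := fun x => x) one_ne_zero
  rw [ProbabilityTheory.integral_id_gaussianReal] at h
  simpa using h.symm

lemma integral_gaussianPDFReal_mul_self_mul_self :
    ∫ x, ProbabilityTheory.gaussianPDFReal 0 1 x * (x * x) = 1 := by
  have h := ProbabilityTheory.integral_gaussianReal_eq_integral_smul (μ := 0) (v := 1)
    (f := fun x => x * x) one_ne_zero
  have hv := ProbabilityTheory.variance_id_gaussianReal (μ := 0) (v := 1)
  rw [ProbabilityTheory.variance_eq_integral (by fun_prop)] at hv
  simp only [id_eq, ProbabilityTheory.integral_id_gaussianReal, sub_zero, NNReal.coe_one] at hv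
  simp only [sq] at hv
  rw [hv] at h
  simpa using h.symm

lemma integrable_stdGaussDensity {n : ℕ} : Integrable (stdGaussDensity (n := n)) :=
  Integrable.fintype_prod fun _ => ProbabilityTheory.integrable_gaussianPDFReal 0 1

lemma integral_stdGaussDensity {n : ℕ} : ∫ z : Fin n → ℝ, stdGaussDensity z = 1 := by
  simp only [stdGaussDensity]
  rw [integral_fintype_prod_volume_eq_prod (fun _ => ProbabilityTheory.gaussianPDFReal 0 1)]
  simp [ProbabilityTheory.integral_gaussianPDFReal_eq_one]

lemma integrable_stdGaussDensity_mul_apply {n : ℕ} (i : Fin n) :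
    Integrable fun z : Fin n → ℝ => stdGaussDensity z * z i := by
  simp only [stdGaussDensity_mul_apply]
  refine Integrable.fintype_prod (f := fun k x => ProbabilityTheory.gaussianPDFReal 0 1 x *
    (if k = i then x else 1)) fun k => ?_
  split_ifs
  · simpa using integrable_gaussianPDFReal_mul_pow 1
  · simpa using integrable_gaussianPDFReal_mul_pow 0

lemma integral_stdGaussDensity_mul_apply {n : ℕ} (i : Fin n) :
    ∫ z : Fin n → ℝ, stdGaussDensity z * z i = 0 := by
  simp only [stdGaussDensity_mul_apply]
  rw [integral_fintype_prod_volume_eq_prod (fun k x => ProbabilityTheory.gaussianPDFReal 0 1 x *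
    (if k = i then x else 1))]
  refine Finset.prod_eq_zero (Finset.mem_univ i) ?_
  simp [integral_gaussianPDFReal_mul_self]

lemma integrable_stdGaussDensity_mul_apply_mul_apply {n : ℕ} (i j : Fin n) :
    Integrable fun z : Fin n → ℝ => stdGaussDensity z * (z i * z j) := by
  simp only [stdGaussDensity_mul_apply_mul_apply]
  refine Integrable.fintype_prod (f := fun k x => ProbabilityTheory.gaussianPDFReal 0 1 x *
    ((if k = i then x else 1) * (if k = j then x else 1))) fun k => ?_
  split_ifs
  · simpa [sq] using integrable_gaussianPDFReal_mul_pow 2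
  · simpa using integrable_gaussianPDFReal_mul_pow 1
  · simpa using integrable_gaussianPDFReal_mul_pow 1
  · simpa using integrable_gaussianPDFReal_mul_pow 0

lemma integral_stdGaussDensity_mul_apply_mul_apply {n : ℕ} (i j : Fin n) :
    ∫ z : Fin n → ℝ, stdGaussDensity z * (z i * z j) = if i = j then 1 else 0 := by
  simp only [stdGaussDensity_mul_apply_mul_apply]
  rw [integral_fintype_prod_volume_eq_prod (fun k x => ProbabilityTheory.gaussianPDFReal 0 1 x *
    ((if k = i then x else 1) * (if k = j then x else 1)))]
  split_ifs with h
  · subst h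
    refine Finset.prod_eq_one fun k _ => ?_
    split_ifs
    · exact integral_gaussianPDFReal_mul_self_mul_self
    · simpa using ProbabilityTheory.integral_gaussianPDFReal_eq_one 0 one_ne_zero
  · refine Finset.prod_eq_zero (Finset.mem_univ i) ?_
    simp [h, integral_gaussianPDFReal_mul_self]

/-- Mean of an affine-quadratic function under the standard Gaussian density. -/
lemma integral_stdGaussDensity_mul_quadratic {n : ℕ} (c : ℝ) (b : Fin n → ℝ)
    (M : Matrix (Fin n) (Fin n) ℝ) :
    ∫ z : Fin n → ℝ, stdGaussDensity z * (c + b ⬝ᵥ z + z ⬝ᵥ (M *ᵥ z)) = c + M.trace := by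
  have hexp : ∀ z : Fin n → ℝ, stdGaussDensity z * (c + b ⬝ᵥ z + z ⬝ᵥ (M *ᵥ z)) =
      c * stdGaussDensity z + ∑ i, b i * (stdGaussDensity z * z i)
        + ∑ i, ∑ j, M i j * (stdGaussDensity z * (z i * z j)) := by
    intro z
    simp only [dotProduct, mulVec, Finset.mul_sum, mul_add]
    congr 1
    · congr 1
      · ring
      · exact Finset.sum_congr rfl fun i _ => by ring
    · exact Finset.sum_congr rfl fun i _ => Finset.sum_congr rfl fun j _ => by ring
  have h0 := integrable_stdGaussDensity (n := n)
  have h1 := integrable_stdGaussDensity_mul_apply (n := n)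
  have h2 := integrable_stdGaussDensity_mul_apply_mul_apply (n := n)
  simp_rw [hexp]
  rw [integral_add, integral_add, integral_const_mul, integral_stdGaussDensity,
    integral_finsetSum, integral_finsetSum]
  · have : ∀ i, ∫ z : Fin n → ℝ, ∑ j, M i j * (stdGaussDensity z * (z i * z j)) = M i i := by
      intro i
      rw [integral_finsetSum _ fun j _ => (h2 i j).const_mul _]
      simp [integral_const_mul, integral_stdGaussDensity_mul_apply_mul_apply]
    simp [this, integral_const_mul, integral_stdGaussDensity_mul_apply, Matrix.trace]
  · exact fun i _ => integrable_finsetSum _ fun j _ => (h2 i j).const_mul _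
  · exact fun i _ => (h1 i).const_mul _
  · exact h0.const_mul _
  · exact integrable_finsetSum _ fun i _ => (h1 i).const_mul _
  · exact (h0.const_mul _).add (integrable_finsetSum _ fun i _ => (h1 i).const_mul _)
  · exact integrable_finsetSum _ fun i _ => integrable_finsetSum _ fun j _ => (h2 i j).const_mul _

lemma integral_gaussDensity {n : ℕ} (μ : Fin n → ℝ) {C : Matrix (Fin n) (Fin n) ℝ}
    (hC : C.PosDef) : ∫ x, gaussDensity μ C x = 1 := by
  obtain ⟨L, rfl, hL⟩ := hC.exists_eq_mul_transpose
  simpa [integral_stdGaussDensity] using integral_gaussDensity_mul μ hL fun _ => 1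

/-- Mean of a constant plus a quadratic form in an affine image of a Gaussian vector. -/
lemma integral_gaussDensity_mul_quadratic {m n : ℕ} (μ : Fin n → ℝ)
    {C : Matrix (Fin n) (Fin n) ℝ} (hC : C.PosDef) (W : Matrix (Fin m) (Fin n) ℝ)
    (Q : Matrix (Fin m) (Fin m) ℝ) (x : Fin m → ℝ) (c : ℝ) :
    ∫ b, gaussDensity μ C b * (c + (x - W *ᵥ b) ⬝ᵥ (Q *ᵥ (x - W *ᵥ b))) =
      c + ((x - W *ᵥ μ) ⬝ᵥ (Q *ᵥ (x - W *ᵥ μ)) + (Q * (W * C * Wᵀ)).trace) := by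
  obtain ⟨L, rfl, hL⟩ := hC.exists_eq_mul_transpose
  rw [integral_gaussDensity_mul μ hL]
  set y := x - W *ᵥ μ with hy
  have hq : ∀ z : Fin n → ℝ,
      (x - W *ᵥ (L *ᵥ z + μ)) ⬝ᵥ (Q *ᵥ (x - W *ᵥ (L *ᵥ z + μ))) =
      y ⬝ᵥ (Q *ᵥ y) + (-(y ᵥ* (Q * (W * L))) - (Q *ᵥ y) ᵥ* (W * L)) ⬝ᵥ z
        + z ⬝ᵥ (((W * L)ᵀ * Q * (W * L)) *ᵥ z) := by
    intro z
    have hx : x - W *ᵥ (L *ᵥ z + μ) = y - (W * L) *ᵥ z := by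
      rw [hy, mulVec_add, mulVec_mulVec]; abel
    have e1 : (y ᵥ* (Q * (W * L))) ⬝ᵥ z = y ⬝ᵥ (Q *ᵥ ((W * L) *ᵥ z)) := by
      rw [← dotProduct_mulVec, mulVec_mulVec]
    have e2 : ((Q *ᵥ y) ᵥ* (W * L)) ⬝ᵥ z = ((W * L) *ᵥ z) ⬝ᵥ (Q *ᵥ y) := by
      rw [← dotProduct_mulVec, dotProduct_comm]
    have e3 : z ⬝ᵥ (((W * L)ᵀ * Q * (W * L)) *ᵥ z) =
        ((W * L) *ᵥ z) ⬝ᵥ (Q *ᵥ ((W * L) *ᵥ z)) := by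
      rw [Matrix.mul_assoc, ← mulVec_mulVec, dotProduct_mulVec, vecMul_transpose, mulVec_mulVec]
    rw [hx, e3, sub_dotProduct (-_), neg_dotProduct, e1, e2, mulVec_sub, sub_dotProduct, dotProduct_sub,
      dotProduct_sub]
    ring
  simp_rw [hq, ← add_assoc]
  rw [integral_stdGaussDensity_mul_quadratic]
  congr 1
  rw [Matrix.mul_assoc, Matrix.trace_mul_comm, Matrix.mul_assoc, transpose_mul]
  simp only [Matrix.mul_assoc]

/-! ### Bordered matrices -/

/-- The symmetric matrix obtained by bordering `A` with the vector `u` and the corner `d`. -/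
def borderMatrix {r : ℕ} (A : Matrix (Fin r) (Fin r) ℝ) (u : Fin r → ℝ) (d : ℝ) :
    Matrix (Fin r ⊕ Fin 1) (Fin r ⊕ Fin 1) ℝ :=
  fromBlocks A (replicateCol (Fin 1) u) (replicateRow (Fin 1) u) (of fun _ _ => d)

lemma transpose_eq_of_posDef {n : Type*} [Fintype n] {A : Matrix n n ℝ} (hA : A.PosDef) :
    Aᵀ = A := by
  simpa [IsHermitian, conjTranspose_eq_transpose_of_trivial] using hA.isHermitian

lemma det_borderMatrix {r : ℕ} {A : Matrix (Fin r) (Fin r) ℝ} (hA : A.PosDef)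
    (w : Fin r → ℝ) (s : ℝ) :
    (borderMatrix A (A *ᵥ w) (s + w ⬝ᵥ (A *ᵥ w))).det = A.det * s := by
  have hu : IsUnit A.det := hA.det_pos.ne'.isUnit
  have := A.invertibleOfIsUnitDet hu
  rw [borderMatrix, det_fromBlocks₁₁]
  congr 1
  rw [det_fin_one, invOf_eq_nonsing_inv]
  have h : replicateRow (Fin 1) (A *ᵥ w) * A⁻¹ * replicateCol (Fin 1) (A *ᵥ w) =
      of fun _ _ => w ⬝ᵥ (A *ᵥ w) := by
    ext i j
    rw [Matrix.mul_assoc, ← replicateCol_mulVec, mulVec_mulVec, nonsing_inv_mul _ hu, one_mulVec]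
    simp [Matrix.mul_apply, dotProduct, mul_comm]
  rw [h]
  simp

lemma posDef_borderMatrix_iff {r : ℕ} {A : Matrix (Fin r) (Fin r) ℝ} (hA : A.PosDef)
    (w : Fin r → ℝ) (s : ℝ) :
    (borderMatrix A (A *ᵥ w) (s + w ⬝ᵥ (A *ᵥ w))).PosDef ↔ 0 < s := by
  have hu : IsUnit A.det := hA.det_pos.ne'.isUnit
  constructor
  · intro h
    have := h.det_pos
    rw [det_borderMatrix hA] at this
    exact (mul_pos_iff_of_pos_left hA.det_pos).1 this
  · intro hs
    have := A.invertibleOfIsUnitDet hu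
    have hps : (borderMatrix A (A *ᵥ w) (s + w ⬝ᵥ (A *ᵥ w))).PosSemidef := by
      have hrow : replicateRow (Fin 1) (A *ᵥ w) = (replicateCol (Fin 1) (A *ᵥ w))ᴴ := by
        ext; simp
      rw [borderMatrix, hrow, PosDef.fromBlocks₁₁ _ _ hA, ← hrow]
      have h : (of fun _ _ => s + w ⬝ᵥ (A *ᵥ w)) - replicateRow (Fin 1) (A *ᵥ w) * A⁻¹ *
          replicateCol (Fin 1) (A *ᵥ w) = diagonal fun _ => s := by
        ext i j
        rw [Matrix.mul_assoc, ← replicateCol_mulVec, mulVec_mulVec, nonsing_inv_mul _ hu,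
          one_mulVec]
        simp [Matrix.mul_apply, dotProduct, mul_comm, Subsingleton.elim i j]
      rw [h]
      exact PosSemidef.diagonal fun _ => hs.le
    rw [hps.posDef_iff_det_ne_zero, det_borderMatrix hA]
    exact (mul_pos hA.det_pos hs).ne'

lemma trace_fromBlocks_eq {m n : Type*} [Fintype m] [Fintype n] (A : Matrix m m ℝ)
    (B : Matrix m n ℝ) (C : Matrix n m ℝ) (D : Matrix n n ℝ) :
    (fromBlocks A B C D).trace = A.trace + D.trace := by
  simp [Matrix.trace, Fintype.sum_sum_type]

lemma trace_mul_inv_borderMatrix {r : ℕ} {E : Matrix (Fin r) (Fin r) ℝ} (hE : E.PosDef)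
    (w : Fin r → ℝ) {s : ℝ} (hs : 0 < s) (A : Matrix (Fin r) (Fin r) ℝ) (u : Fin r → ℝ) (c : ℝ) :
    (borderMatrix A u c * (borderMatrix E (E *ᵥ w) (s + w ⬝ᵥ (E *ᵥ w)))⁻¹).trace =
      (A * E⁻¹).trace + s⁻¹ * (w ⬝ᵥ (A *ᵥ w) - 2 * (u ⬝ᵥ w) + c) := by
  have hu : IsUnit E.det := hE.det_pos.ne'.isUnit
  have hsne : s ≠ 0 := hs.ne'
  have hinv : (borderMatrix E (E *ᵥ w) (s + w ⬝ᵥ (E *ᵥ w)))⁻¹ =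
      fromBlocks (E⁻¹ + s⁻¹ • vecMulVec w w) (-(s⁻¹ • replicateCol (Fin 1) w))
        (-(s⁻¹ • replicateRow (Fin 1) w)) (of fun _ _ => s⁻¹) := by
    apply inv_eq_right_inv
    have hrow : replicateRow (Fin 1) (E *ᵥ w) = replicateRow (Fin 1) w * E := by
      rw [← replicateRow_vecMul, ← mulVec_transpose, transpose_eq_of_posDef hE]
    have hcol : replicateCol (Fin 1) (E *ᵥ w) = E * replicateCol (Fin 1) w := by
      rw [← replicateCol_mulVec]
    have hvv : vecMulVec w w = replicateCol (Fin 1) w * replicateRow (Fin 1) w :=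
      vecMulVec_eq (Fin 1) w w
    have hcorner : (of fun _ _ => s⁻¹ : Matrix (Fin 1) (Fin 1) ℝ) = s⁻¹ • 1 := by
      ext i j; simp [Subsingleton.elim i j]
    have hdd : (of fun _ _ => s + w ⬝ᵥ (E *ᵥ w) : Matrix (Fin 1) (Fin 1) ℝ) =
        s • 1 + replicateRow (Fin 1) w * (E * replicateCol (Fin 1) w) := by
      rw [← hcol]
      ext i j; simp [Subsingleton.elim i j, Matrix.mul_apply, dotProduct]
    rw [borderMatrix, fromBlocks_multiply, hrow, hcol, hvv, hcorner, hdd, ← fromBlocks_one]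
    congr 1
    · rw [Matrix.mul_add, mul_nonsing_inv _ hu]
      simp [Matrix.mul_assoc]
    · simp
    · rw [Matrix.mul_add, Matrix.mul_assoc, mul_nonsing_inv _ hu]
      simp [Matrix.mul_assoc, Matrix.add_mul, smul_smul, hsne]
    · simp [Matrix.mul_assoc, smul_smul, hsne]
  rw [hinv, borderMatrix, fromBlocks_multiply, trace_fromBlocks_eq, Matrix.mul_add]
  have e1 : (A * vecMulVec w w).trace = w ⬝ᵥ (A *ᵥ w) := by
    rw [Matrix.trace_mul_comm, vecMulVec_mul, trace_vecMulVec, dotProduct_mulVec, dotProduct_comm]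
  have e2 : (replicateCol (Fin 1) u * replicateRow (Fin 1) w).trace = u ⬝ᵥ w := by
    simp [Matrix.trace, Matrix.mul_apply, dotProduct]
  have e3 : (replicateRow (Fin 1) u * replicateCol (Fin 1) w).trace = u ⬝ᵥ w := by
    simp [Matrix.trace, Matrix.mul_apply, dotProduct]
  have e4 : ((of fun _ _ => c : Matrix (Fin 1) (Fin 1) ℝ) * of fun _ _ => s⁻¹).trace = c * s⁻¹ := by
    simp [Matrix.trace, Matrix.mul_apply]
  simp only [trace_add, Matrix.mul_neg, Matrix.mul_smul, trace_neg, trace_smul, e1, e2, e3, e4,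
    smul_eq_mul]
  ring

/-- A positive definite matrix of size `r + 1` is a bordering of its leading block. -/
lemma Matrix.PosDef.exists_eq_borderMatrix {r : ℕ} {S : Matrix (Fin (r + 1)) (Fin (r + 1)) ℝ}
    (hS : S.PosDef) : ∃ (A : Matrix (Fin r) (Fin r) ℝ) (w : Fin r → ℝ) (s : ℝ),
      A.PosDef ∧ 0 < s ∧
        S.submatrix finSumFinEquiv finSumFinEquiv =
          borderMatrix A (A *ᵥ w) (s + w ⬝ᵥ (A *ᵥ w)) := by
  have hsym := transpose_eq_of_posDef hS
  have hA : (S.submatrix Fin.castSucc Fin.castSucc).PosDef :=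
    hS.submatrix (Fin.castSucc_injective r)
  set A := S.submatrix Fin.castSucc Fin.castSucc with hAdef
  set u : Fin r → ℝ := fun i => S i.castSucc (Fin.last r) with hu
  set w := A⁻¹ *ᵥ u with hw
  have hAw : A *ᵥ w = u := by
    rw [hw, mulVec_mulVec, mul_nonsing_inv _ hA.det_pos.ne'.isUnit, one_mulVec]
  have heq : S.submatrix finSumFinEquiv finSumFinEquiv =
      borderMatrix A (A *ᵥ w)
        ((S (Fin.last r) (Fin.last r) - w ⬝ᵥ (A *ᵥ w)) + w ⬝ᵥ (A *ᵥ w)) := by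
    rw [sub_add_cancel, hAw]
    have hlast : ∀ i : Fin 1, Fin.natAdd r i = Fin.last r := by
      intro i; ext; simp
    ext (i | i) (j | j)
    · rfl
    · simp [borderMatrix, hlast, hu]; rfl
    · simp only [borderMatrix, submatrix_apply, finSumFinEquiv_apply_left,
        finSumFinEquiv_apply_right, hlast, fromBlocks_apply₂₁, replicateRow_apply, hu]
      conv_lhs => rw [← hsym]
      rfl
    · simp [borderMatrix, hlast]
  refine ⟨A, w, _, hA, ?_, heq⟩
  rw [← posDef_borderMatrix_iff hA w, ← heq]
  exact hS.submatrix finSumFinEquiv.injective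

/-! ### Coordinates on symmetric matrices -/

/-- Index set of the on-and-below-diagonal entries. -/
abbrev LowerIndex (r : ℕ) : Type := {q : Fin r × Fin r // q.2 ≤ q.1}

/-- The on-and-below-diagonal entries of size `r + 1`: those of the leading block, followed by the
last row. -/
noncomputable def lowerIndexSumEquiv (r : ℕ) : LowerIndex r ⊕ (Fin r ⊕ Unit) ≃ LowerIndex (r + 1) :=
  Equiv.ofBijective
    (Sum.elim (fun q => ⟨(q.1.1.castSucc, q.1.2.castSucc), Fin.castSucc_le_castSucc_iff.2 q.2⟩)
      (Sum.elim (fun j => ⟨(Fin.last r, j.castSucc), Fin.le_last _⟩)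
        fun _ => ⟨(Fin.last r, Fin.last r), le_rfl⟩))
    (by
      constructor
      · rintro (⟨⟨a, b⟩, h⟩ | a | a) (⟨⟨a', b'⟩, h'⟩ | a' | a') hab <;>
          simp_all [Fin.ext_iff] <;> omega
      · rintro ⟨⟨a, b⟩, h⟩
        induction a using Fin.lastCases with
        | last =>
          induction b using Fin.lastCases with
          | last => exact ⟨Sum.inr (Sum.inr ()), rfl⟩
          | cast b => exact ⟨Sum.inr (Sum.inl b), rfl⟩
        | cast a =>
          induction b using Fin.lastCases with
          | last => exact absurd h (not_le.2 (Fin.castSucc_lt_last a))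
          | cast b => exact ⟨Sum.inl ⟨(a, b), Fin.castSucc_le_castSucc_iff.1 h⟩, rfl⟩)

/-- Entries of the bordered matrix in terms of those of the leading block and of the last row. -/
noncomputable def joinLower {r : ℕ} (v : LowerIndex r → ℝ) (u : Fin r → ℝ) (d : ℝ) :
    LowerIndex (r + 1) → ℝ :=
  fun q => Sum.elim v (Sum.elim u fun _ => d) ((lowerIndexSumEquiv r).symm q)

lemma lowerToSym_transpose {r : ℕ} (v : LowerIndex r → ℝ) : (lowerToSym v)ᵀ = lowerToSym v := by
  ext i j
  simp only [lowerToSym, transpose_apply, of_apply]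
  rcases lt_trichotomy i j with h | rfl | h
  · simp [h.le, not_le.2 h]
  · rfl
  · simp [h.le, not_le.2 h]

lemma lowerToSym_joinLower {r : ℕ} (v : LowerIndex r → ℝ) (u : Fin r → ℝ) (d : ℝ) :
    (lowerToSym (joinLower v u d)).submatrix finSumFinEquiv finSumFinEquiv =
      borderMatrix (lowerToSym v) u d := by
  have hlast : ∀ i : Fin 1, Fin.natAdd r i = Fin.last r := by
    intro i; ext; simp
  have hjoin : ∀ x, joinLower v u d (lowerIndexSumEquiv r x) =
      Sum.elim v (Sum.elim u fun _ => d) x := by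
    intro x; simp [joinLower]
  have hblock : ∀ i j (h : j ≤ i), joinLower v u d
      ⟨(i.castSucc, j.castSucc), Fin.castSucc_le_castSucc_iff.2 h⟩ = v ⟨(i, j), h⟩ :=
    fun i j h => hjoin (Sum.inl ⟨(i, j), h⟩)
  have hrow : ∀ j, joinLower v u d ⟨(Fin.last r, j.castSucc), Fin.le_last _⟩ = u j :=
    fun j => hjoin (Sum.inr (Sum.inl j))
  have hcorner : joinLower v u d ⟨(Fin.last r, Fin.last r), le_rfl⟩ = d :=
    hjoin (Sum.inr (Sum.inr ()))
  have hcast : ∀ i : Fin r, Fin.castAdd 1 i = i.castSucc := fun _ => rfl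
  ext (i | i) (j | j)
  · simp only [submatrix_apply, finSumFinEquiv_apply_left, hcast, lowerToSym, of_apply,
      borderMatrix, fromBlocks_apply₁₁]
    by_cases h : j ≤ i
    · simp [h, hblock]
    · simp [h, hblock _ _ (not_le.1 h).le]
  · simp [hcast, lowerToSym, borderMatrix, hlast, hrow, not_le.2 (Fin.castSucc_lt_last i)]
  · simp [hcast, lowerToSym, borderMatrix, hlast, hrow, Fin.le_last]
  · simp [lowerToSym, borderMatrix, hlast, hcorner]

lemma measurable_joinLower (r : ℕ) :
    Measurable fun x : (LowerIndex r → ℝ) × (Fin r → ℝ) × ℝ => joinLower x.1 x.2.1 x.2.2 := by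
  refine measurable_pi_iff.2 fun q => ?_
  simp only [joinLower]
  rcases (lowerIndexSumEquiv r).symm q with i | i | i <;> simp only [Sum.elim_inl, Sum.elim_inr] <;>
    fun_prop

lemma measurePreserving_joinLower (r : ℕ) :
    MeasurePreserving fun x : (LowerIndex r → ℝ) × (Fin r → ℝ) × ℝ =>
      joinLower x.1 x.2.1 x.2.2 := by
  have h1 := volume_measurePreserving_piCongrLeft (fun _ => ℝ) (lowerIndexSumEquiv r)
  have h2 := volume_measurePreserving_sumPiEquivProdPi_symm
    (fun _ : LowerIndex r ⊕ (Fin r ⊕ Unit) => ℝ)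
  have h3 := volume_measurePreserving_sumPiEquivProdPi_symm (fun _ : Fin r ⊕ Unit => ℝ)
  have h4 := (volume_preserving_funUnique Unit ℝ).symm
  have h5 := (MeasurePreserving.id (volume : Measure (LowerIndex r → ℝ))).prod
    (h3.comp ((MeasurePreserving.id (volume : Measure (Fin r → ℝ))).prod h4))
  refine (congrArg (fun g => MeasurePreserving g volume volume) (funext fun x => funext fun q => ?_)).mpr
    (h1.comp (h2.comp h5))
  obtain ⟨y, rfl⟩ := (lowerIndexSumEquiv r).surjective q
  simp only [joinLower, Equiv.symm_apply_apply, Function.comp_apply,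
    MeasurableEquiv.coe_piCongrLeft, Equiv.piCongrLeft_apply_apply]
  rcases y with i | i | i <;> rfl

lemma lintegral_lowerIndex_succ {r : ℕ} {F : (LowerIndex (r + 1) → ℝ) → ENNReal}
    (hF : Measurable F) :
    ∫⁻ v, F v = ∫⁻ v, ∫⁻ u, ∫⁻ d, F (joinLower v u d) := by
  have hm : Measurable fun x : (LowerIndex r → ℝ) × (Fin r → ℝ) × ℝ =>
      F (joinLower x.1 x.2.1 x.2.2) := hF.comp (measurable_joinLower r)
  rw [← (measurePreserving_joinLower r).lintegral_comp hF, Measure.volume_eq_prod,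
    lintegral_prod _ hm.aemeasurable]
  refine lintegral_congr fun v => ?_
  have hmv : Measurable fun x : (Fin r → ℝ) × ℝ => F (joinLower v x.1 x.2) :=
    hm.comp measurable_prodMk_left
  rw [Measure.volume_eq_prod, lintegral_prod _ hmv.aemeasurable]

lemma continuous_lowerToSym (r : ℕ) : Continuous (lowerToSym (r := r)) := by
  refine continuous_matrix fun i j => ?_
  simp only [lowerToSym, of_apply]
  split_ifs <;> fun_prop

lemma measurableSet_posDef (r : ℕ) :
    MeasurableSet {v : LowerIndex r → ℝ | (lowerToSym v).PosDef} := by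
  have hset : {v : LowerIndex r → ℝ | (lowerToSym v).PosDef} =
      {v | ∀ x : Fin r → ℝ, 0 ≤ x ⬝ᵥ (lowerToSym v *ᵥ x)} ∩ {v | (lowerToSym v).det ≠ 0} := by
    ext v
    have hherm : (lowerToSym v).IsHermitian := by
      simpa [IsHermitian, conjTranspose_eq_transpose_of_trivial] using lowerToSym_transpose v
    constructor
    · intro h
      exact ⟨fun x => by simpa using h.posSemidef.dotProduct_mulVec_nonneg x, h.det_pos.ne'⟩
    · rintro ⟨h1, h2⟩
      have hps : (lowerToSym v).PosSemidef :=
        PosSemidef.of_dotProduct_mulVec_nonneg hherm fun x => by simpa using h1 x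
      exact hps.posDef_iff_det_ne_zero.2 h2
  rw [hset]
  refine MeasurableSet.inter ?_ ?_
  · rw [Set.ofPred_forall]
    refine (isClosed_iInter fun x => isClosed_le continuous_const ?_).measurableSet
    exact continuous_const.dotProduct ((continuous_lowerToSym r).matrix_mulVec continuous_const)
  · exact (isOpen_ne_fun (continuous_lowerToSym r).matrix_det continuous_const).measurableSet

lemma measurable_det_lowerToSym (r : ℕ) :
    Measurable fun v : LowerIndex r → ℝ => (lowerToSym v).det :=
  (continuous_lowerToSym r).matrix_det.measurable

lemma measurable_trace_mul_inv_lowerToSym {r : ℕ} (S : Matrix (Fin r) (Fin r) ℝ) :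
    Measurable fun v : LowerIndex r → ℝ => (S * (lowerToSym v)⁻¹).trace := by
  simp only [Matrix.inv_def, Ring.inverse_eq_inv', Matrix.mul_smul, trace_smul, smul_eq_mul]
  exact (measurable_det_lowerToSym r).inv.mul
    (continuous_const.matrix_mul (continuous_lowerToSym r).matrix_adjugate).matrix_trace.measurable

/-! ### Normalizing constant of the inverse Wishart density -/

/-- The unnormalized inverse Wishart density. -/
noncomputable def invWishartKernel {r : ℕ} (ν : ℝ) (S D : Matrix (Fin r) (Fin r) ℝ) : ℝ :=
  D.det ^ (-(ν + (r : ℝ) + 1) / 2) * Real.exp (-(1 / 2) * (S * D⁻¹).trace)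

/-- The normalizing constant of the inverse Wishart density. -/
noncomputable def invWishartConst {r : ℕ} (ν : ℝ) (S : Matrix (Fin r) (Fin r) ℝ) : ℝ :=
  S.det ^ (-ν / 2) * (2 : ℝ) ^ (ν * (r : ℝ) / 2) * multivariateGamma r (ν / 2)

lemma measurable_invWishartKernel_lowerToSym {r : ℕ} (ν : ℝ) (S : Matrix (Fin r) (Fin r) ℝ) :
    Measurable fun v : LowerIndex r → ℝ => invWishartKernel ν S (lowerToSym v) :=
  ((measurable_det_lowerToSym r).pow_const _).mul
    ((measurable_trace_mul_inv_lowerToSym S).const_mul _).exp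

lemma multivariateGamma_succ (r : ℕ) (a : ℝ) :
    multivariateGamma (r + 1) a =
      Real.pi ^ ((r : ℝ) / 2) * Real.Gamma a * multivariateGamma r (a - 1 / 2) := by
  have hprod : ∏ l ∈ Finset.Icc 1 (r + 1), Real.Gamma (a + (1 - (l : ℝ)) / 2) =
      Real.Gamma a * ∏ l ∈ Finset.Icc 1 r, Real.Gamma (a - 1 / 2 + (1 - (l : ℝ)) / 2) := by
    rw [← Finset.Ico_add_one_right_eq_Icc, ← Finset.Ico_add_one_right_eq_Icc,
      Finset.prod_Ico_eq_prod_range, Finset.prod_Ico_eq_prod_range, Nat.add_sub_cancel,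
      Nat.add_sub_cancel, Finset.prod_range_succ']
    rw [mul_comm]
    congr 1
    · simp
    · refine Finset.prod_congr rfl fun k _ => ?_
      congr 1; push_cast; ring
  have hpi : Real.pi ^ (((r + 1 : ℕ) : ℝ) * (((r + 1 : ℕ) : ℝ) - 1) / 4) =
      Real.pi ^ ((r : ℝ) / 2) * Real.pi ^ ((r : ℝ) * ((r : ℝ) - 1) / 4) := by
    rw [← Real.rpow_add Real.pi_pos]
    congr 1; push_cast; ring
  rw [multivariateGamma, multivariateGamma, hprod, hpi]
  ring

lemma multivariateGamma_pos {r : ℕ} {ν : ℝ} (hν : (r : ℝ) - 1 < ν) :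
    0 < multivariateGamma r (ν / 2) := by
  refine mul_pos (Real.rpow_pos_of_pos Real.pi_pos _) (Finset.prod_pos fun l hl => ?_)
  have hl' : (l : ℝ) ≤ r := by exact_mod_cast (Finset.mem_Icc.1 hl).2
  exact Real.Gamma_pos_of_pos (by linarith)

lemma invWishartConst_pos {r : ℕ} {ν : ℝ} (hν : (r : ℝ) - 1 < ν)
    {S : Matrix (Fin r) (Fin r) ℝ} (hS : S.PosDef) : 0 < invWishartConst ν S :=
  mul_pos (mul_pos (Real.rpow_pos_of_pos hS.det_pos _) (by positivity)) (multivariateGamma_pos hν)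

lemma lintegral_exp_neg_quadratic {r : ℕ} {A : Matrix (Fin r) (Fin r) ℝ} (hA : A.PosDef)
    (w₀ : Fin r → ℝ) {s : ℝ} (hs : 0 < s) :
    ∫⁻ w : Fin r → ℝ,
        ENNReal.ofReal (Real.exp (-(1 / 2) * (s⁻¹ * ((w - w₀) ⬝ᵥ (A *ᵥ (w - w₀)))))) =
      ENNReal.ofReal ((2 * Real.pi) ^ ((r : ℝ) / 2) * s ^ ((r : ℝ) / 2) *
        A.det ^ (-(1 : ℝ) / 2)) := by
  have hu : IsUnit A.det := hA.det_pos.ne'.isUnit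
  have hC : (s • A⁻¹).PosDef := hA.inv.smul hs
  have hCinv : (s • A⁻¹)⁻¹ = s⁻¹ • A := by
    apply inv_eq_right_inv
    rw [smul_mul_smul_comm, mul_inv_cancel₀ hs.ne', nonsing_inv_mul _ hu, one_smul]
  have hdet : (s • A⁻¹).det = s ^ (r : ℝ) * A.det⁻¹ := by
    rw [det_smul, Fintype.card_fin, det_nonsing_inv, Ring.inverse_eq_inv', Real.rpow_natCast]
  have h1 := integral_gaussDensity w₀ hC
  have hconst : ((2 * Real.pi) ^ (-(r : ℝ) / 2) * (s • A⁻¹).det ^ (-(1 : ℝ) / 2)) =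
      ((2 * Real.pi) ^ ((r : ℝ) / 2) * s ^ ((r : ℝ) / 2) * A.det ^ (-(1 : ℝ) / 2))⁻¹ := by
    have hspow : (s ^ (r : ℝ)) ^ (-(1 : ℝ) / 2) = (s ^ ((r : ℝ) / 2))⁻¹ := by
      rw [← Real.rpow_mul hs.le, ← Real.rpow_neg hs.le]; congr 1; ring
    rw [hdet, Real.mul_rpow (by positivity) (inv_nonneg.2 hA.det_pos.le), hspow,
      Real.inv_rpow hA.det_pos.le, neg_div, Real.rpow_neg (x := 2 * Real.pi) (by positivity),
      mul_inv, mul_inv, mul_assoc]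
  have hpos : 0 < (2 * Real.pi) ^ ((r : ℝ) / 2) * s ^ ((r : ℝ) / 2) * A.det ^ (-(1 : ℝ) / 2) :=
    mul_pos (by positivity) (Real.rpow_pos_of_pos hA.det_pos _)
  simp only [gaussDensity, hconst, hCinv, smul_mulVec, dotProduct_smul, smul_eq_mul] at h1
  rw [integral_const_mul, inv_mul_eq_one₀ hpos.ne'] at h1
  rw [h1, ofReal_integral_eq_lintegral_ofReal]
  · exact Integrable.of_integral_ne_zero (h1 ▸ hpos.ne')
  · exact Filter.Eventually.of_forall fun _ => (Real.exp_pos _).le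

/-- The normalizing constant of the inverse Gamma density. -/
lemma lintegral_inverseGamma {a c : ℝ} (ha : 0 < a) (hc : 0 < c) :
    ∫⁻ s in Set.Ioi (0 : ℝ), ENNReal.ofReal (s ^ (-a - 1) * Real.exp (-(c * s⁻¹))) =
      ENNReal.ofReal (c ^ (-a) * Real.Gamma a) := by
  have h := integral_comp_rpow_Ioi (fun y : ℝ => y ^ (a - 1) * Real.exp (-(c * y)))
    (p := -1) (by norm_num)
  rw [Real.integral_rpow_mul_exp_neg_mul_Ioi ha hc] at h
  have heq : ∀ s ∈ Set.Ioi (0 : ℝ), (|(-1 : ℝ)| * s ^ ((-1 : ℝ) - 1)) •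
      ((s ^ (-1 : ℝ)) ^ (a - 1) * Real.exp (-(c * s ^ (-1 : ℝ)))) =
      s ^ (-a - 1) * Real.exp (-(c * s⁻¹)) := by
    intro s hs
    have hs' : 0 < s := hs
    rw [← Real.rpow_mul hs'.le, abs_neg, abs_one, one_mul, smul_eq_mul, ← mul_assoc,
      ← Real.rpow_add hs', Real.rpow_neg_one]
    congr 2; ring
  rw [setIntegral_congr_fun measurableSet_Ioi heq, one_div, Real.inv_rpow hc.le,
    ← Real.rpow_neg hc.le] at h
  have hpos : 0 < c ^ (-a) * Real.Gamma a :=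
    mul_pos (Real.rpow_pos_of_pos hc _) (Real.Gamma_pos_of_pos ha)
  rw [← h, ofReal_integral_eq_lintegral_ofReal]
  · exact Integrable.of_integral_ne_zero (h ▸ hpos.ne')
  · refine (ae_restrict_iff' measurableSet_Ioi).2 (Filter.Eventually.of_forall fun s hs => ?_)
    have hs' : 0 < s := hs
    positivity

lemma posDef_submatrix_finSumFinEquiv_iff {r : ℕ} {D : Matrix (Fin (r + 1)) (Fin (r + 1)) ℝ} :
    (D.submatrix finSumFinEquiv finSumFinEquiv : Matrix (Fin r ⊕ Fin 1) (Fin r ⊕ Fin 1) ℝ).PosDef ↔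
      D.PosDef := by
  refine ⟨fun h => ?_, fun h => h.submatrix finSumFinEquiv.injective⟩
  simpa using h.submatrix (e := finSumFinEquiv.symm) finSumFinEquiv.symm.injective

lemma posDef_of_posDef_joinLower {r : ℕ} {v : LowerIndex r → ℝ} {u : Fin r → ℝ} {d : ℝ}
    (h : (lowerToSym (joinLower v u d)).PosDef) : (lowerToSym v).PosDef := by
  rw [← posDef_submatrix_finSumFinEquiv_iff, lowerToSym_joinLower] at h
  exact h.submatrix (e := Sum.inl) Sum.inl_injective

lemma trace_mul_inv_submatrix_equiv {m n : Type*} [Fintype m] [Fintype n] [DecidableEq m]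
    [DecidableEq n] (e : m ≃ n) (S D : Matrix n n ℝ) :
    (S.submatrix e e * (D.submatrix e e)⁻¹).trace = (S * D⁻¹).trace := by
  rw [inv_submatrix_equiv, submatrix_mul_equiv]
  simp only [Matrix.trace, diag_apply, submatrix_apply]
  exact e.sum_comp fun i => (S * D⁻¹) i i

/-- The inverse Wishart kernel in the coordinates `(E, w, s)` of
`D = [[E, E w], [wᵀ E, s + wᵀ E w]]`. -/
lemma invWishartKernel_joinLower {r : ℕ} (ν : ℝ) {S : Matrix (Fin (r + 1)) (Fin (r + 1)) ℝ}
    {A : Matrix (Fin r) (Fin r) ℝ} (hA : A.PosDef) {w₀ : Fin r → ℝ} {s₀ : ℝ}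
    (hS : S.submatrix finSumFinEquiv finSumFinEquiv =
      borderMatrix A (A *ᵥ w₀) (s₀ + w₀ ⬝ᵥ (A *ᵥ w₀)))
    {v : LowerIndex r → ℝ} (hv : (lowerToSym v).PosDef) (w : Fin r → ℝ) {s : ℝ} (hs : 0 < s) :
    invWishartKernel ν S (lowerToSym (joinLower v (lowerToSym v *ᵥ w)
        (s + w ⬝ᵥ (lowerToSym v *ᵥ w)))) =
      ((lowerToSym v).det ^ (-(ν + (r : ℝ) + 2) / 2) *
          Real.exp (-(1 / 2) * (A * (lowerToSym v)⁻¹).trace)) *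
        (s ^ (-(ν + (r : ℝ) + 2) / 2) * Real.exp (-(s₀ / 2 * s⁻¹))) *
        Real.exp (-(1 / 2) * (s⁻¹ * ((w - w₀) ⬝ᵥ (A *ᵥ (w - w₀))))) := by
  set E := lowerToSym v with hE
  have hD := lowerToSym_joinLower v (E *ᵥ w) (s + w ⬝ᵥ (E *ᵥ w))
  rw [← hE] at hD
  set D := lowerToSym (joinLower v (E *ᵥ w) (s + w ⬝ᵥ (E *ᵥ w)))
  have hdet : D.det = E.det * s := by
    rw [← det_borderMatrix hv w s, ← hD, det_submatrix_equiv_self]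
  have hsymm : (A *ᵥ w₀) ⬝ᵥ w = w₀ ⬝ᵥ (A *ᵥ w) := by
    rw [dotProduct_mulVec, ← mulVec_transpose, transpose_eq_of_posDef hA]
  have htr : (S * D⁻¹).trace =
      (A * E⁻¹).trace + s⁻¹ * ((w - w₀) ⬝ᵥ (A *ᵥ (w - w₀)) + s₀) := by
    rw [← trace_mul_inv_submatrix_equiv finSumFinEquiv S D, hS, hD,
      trace_mul_inv_borderMatrix hv w hs, mulVec_sub, sub_dotProduct, dotProduct_sub,
      dotProduct_sub, dotProduct_comm w (A *ᵥ w₀), hsymm]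
    ring
  rw [invWishartKernel, hdet, htr, Real.mul_rpow hv.det_pos.le hs.le]
  have hexp : Real.exp (-(1 / 2) * ((A * E⁻¹).trace +
      s⁻¹ * ((w - w₀) ⬝ᵥ (A *ᵥ (w - w₀)) + s₀))) =
      Real.exp (-(1 / 2) * (A * E⁻¹).trace) * Real.exp (-(s₀ / 2 * s⁻¹)) *
        Real.exp (-(1 / 2) * (s⁻¹ * ((w - w₀) ⬝ᵥ (A *ᵥ (w - w₀))))) := by
    rw [← Real.exp_add, ← Real.exp_add]; congr 1; ring
  have hpow : -(ν + ((r + 1 : ℕ) : ℝ) + 1) / 2 = -(ν + (r : ℝ) + 2) / 2 := by push_cast; ring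
  rw [hexp, hpow]
  ring

/-- Integrating out the last row of an inverse Wishart matrix. -/
lemma lintegral_invWishartKernel_joinLower {r : ℕ} {ν : ℝ} (hν : (r : ℝ) < ν)
    {S : Matrix (Fin (r + 1)) (Fin (r + 1)) ℝ}
    {A : Matrix (Fin r) (Fin r) ℝ} (hA : A.PosDef) {w₀ : Fin r → ℝ} {s₀ : ℝ} (hs₀ : 0 < s₀)
    (hS : S.submatrix finSumFinEquiv finSumFinEquiv =
      borderMatrix A (A *ᵥ w₀) (s₀ + w₀ ⬝ᵥ (A *ᵥ w₀)))
    {v : LowerIndex r → ℝ} (hv : (lowerToSym v).PosDef) :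
    ∫⁻ u, ∫⁻ d, Set.indicator {x : LowerIndex (r + 1) → ℝ | (lowerToSym x).PosDef}
        (fun x => ENNReal.ofReal (invWishartKernel ν S (lowerToSym x))) (joinLower v u d) =
      ENNReal.ofReal (invWishartKernel (ν - 1) A (lowerToSym v)) *
        ENNReal.ofReal ((2 * Real.pi) ^ ((r : ℝ) / 2) * A.det ^ (-(1 : ℝ) / 2) *
          ((s₀ / 2) ^ (-(ν / 2)) * Real.Gamma (ν / 2))) := by
  set E := lowerToSym v with hE
  set F := Set.indicator {x : LowerIndex (r + 1) → ℝ | (lowerToSym x).PosDef}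
    (fun x => ENNReal.ofReal (invWishartKernel ν S (lowerToSym x))) with hF
  have hu : IsUnit E.det := hv.det_pos.ne'.isUnit
  set K := E.det ^ (-(ν + (r : ℝ) + 2) / 2) * Real.exp (-(1 / 2) * (A * E⁻¹).trace) with hK
  have hKpos : 0 < K := mul_pos (Real.rpow_pos_of_pos hv.det_pos _) (Real.exp_pos _)
  set h : ℝ → ℝ := fun s => s ^ (-(ν + (r : ℝ) + 2) / 2) * Real.exp (-(s₀ / 2 * s⁻¹)) with hh
  set G : ℝ → (Fin r → ℝ) → ℝ := fun s w =>
    Real.exp (-(1 / 2) * (s⁻¹ * ((w - w₀) ⬝ᵥ (A *ᵥ (w - w₀))))) with hG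
  have hFeq : ∀ (w : Fin r → ℝ) (s : ℝ), F (joinLower v (E *ᵥ w) (s + w ⬝ᵥ (E *ᵥ w))) =
      Set.indicator (Set.Ioi 0) (fun s => ENNReal.ofReal (K * h s) * ENNReal.ofReal (G s w)) s := by
    intro w s
    have hiff : (lowerToSym (joinLower v (E *ᵥ w) (s + w ⬝ᵥ (E *ᵥ w)))).PosDef ↔ 0 < s := by
      rw [← posDef_submatrix_finSumFinEquiv_iff, lowerToSym_joinLower, posDef_borderMatrix_iff hv]
    by_cases hs : 0 < s
    · have hmem : joinLower v (E *ᵥ w) (s + w ⬝ᵥ (E *ᵥ w)) ∈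
          {x : LowerIndex (r + 1) → ℝ | (lowerToSym x).PosDef} := hiff.2 hs
      rw [hF, Set.indicator_of_mem (show s ∈ Set.Ioi (0 : ℝ) from hs),
        Set.indicator_of_mem hmem,
        invWishartKernel_joinLower ν hA hS hv w hs, ENNReal.ofReal_mul]
      have hhpos : 0 < h s := mul_pos (Real.rpow_pos_of_pos hs _) (Real.exp_pos _)
      exact (mul_pos hKpos hhpos).le
    · have hnot : joinLower v (E *ᵥ w) (s + w ⬝ᵥ (E *ᵥ w)) ∉
          {x : LowerIndex (r + 1) → ℝ | (lowerToSym x).PosDef} := fun hmem => hs (hiff.1 hmem)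
      rw [hF, Set.indicator_of_notMem (show s ∉ Set.Ioi (0 : ℝ) from hs),
        Set.indicator_of_notMem hnot]
  have hshift : ∀ u, ∫⁻ d, F (joinLower v u d) =
      ∫⁻ s, F (joinLower v u (s + u ⬝ᵥ (E⁻¹ *ᵥ u))) := fun u =>
    (lintegral_add_right_eq_self (fun d => F (joinLower v u d)) _).symm
  have hcancel : ∀ w : Fin r → ℝ, (E *ᵥ w) ⬝ᵥ (E⁻¹ *ᵥ (E *ᵥ w)) = w ⬝ᵥ (E *ᵥ w) := by
    intro w
    rw [mulVec_mulVec, nonsing_inv_mul _ hu, one_mulVec, dotProduct_comm]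
  simp_rw [hshift]
  rw [lintegral_comp_mulVec hv.det_pos.ne']
  simp_rw [hcancel, hFeq]
  rw [lintegral_lintegral_swap]
  swap
  · refine Measurable.aemeasurable ?_
    have hm : Measurable fun p : (Fin r → ℝ) × ℝ =>
        ENNReal.ofReal (K * h p.2) * ENNReal.ofReal (G p.2 p.1) := by
      have hq : Measurable fun p : (Fin r → ℝ) × ℝ => (p.1 - w₀) ⬝ᵥ (A *ᵥ (p.1 - w₀)) :=
        Continuous.measurable ((continuous_fst.sub continuous_const).dotProduct
          (continuous_const.matrix_mulVec (continuous_fst.sub continuous_const)))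
      simp only [hh, hG]
      fun_prop
    exact hm.indicator (measurable_snd measurableSet_Ioi)
  have hinner : ∀ s, ∫⁻ w, Set.indicator (Set.Ioi 0)
        (fun s => ENNReal.ofReal (K * h s) * ENNReal.ofReal (G s w)) s =
      Set.indicator (Set.Ioi 0) (fun s => ENNReal.ofReal
        (K * ((2 * Real.pi) ^ ((r : ℝ) / 2) * A.det ^ (-(1 : ℝ) / 2))) *
        ENNReal.ofReal (s ^ (-(ν / 2) - 1) * Real.exp (-(s₀ / 2 * s⁻¹)))) s := by
    intro s
    by_cases hs : 0 < s
    · have hs' : s ∈ Set.Ioi (0 : ℝ) := hs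
      have hhpos : 0 < h s := mul_pos (Real.rpow_pos_of_pos hs _) (Real.exp_pos _)
      have hApos := Real.rpow_pos_of_pos hA.det_pos (-(1 : ℝ) / 2)
      simp only [Set.indicator_of_mem hs']
      rw [lintegral_const_mul' _ _ ENNReal.ofReal_ne_top, lintegral_exp_neg_quadratic hA w₀ hs,
        ← ENNReal.ofReal_mul (mul_pos hKpos hhpos).le, ← ENNReal.ofReal_mul (by positivity)]
      have hpow : s ^ (-(ν / 2) - 1) = s ^ (-(ν + (r : ℝ) + 2) / 2) * s ^ ((r : ℝ) / 2) := by
        rw [← Real.rpow_add hs]; congr 1; ring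
      rw [hpow, hh]
      congr 1
      ring
    · have hs' : s ∉ Set.Ioi (0 : ℝ) := hs
      simp [Set.indicator_of_notMem hs']
  simp_rw [hinner]
  rw [lintegral_indicator measurableSet_Ioi, lintegral_const_mul' _ _ ENNReal.ofReal_ne_top,
    lintegral_inverseGamma (by have := r.cast_nonneg (α := ℝ); linarith) (by positivity)]
  have hApos := Real.rpow_pos_of_pos hA.det_pos (-(1 : ℝ) / 2)
  have hkern : E.det * K = invWishartKernel (ν - 1) A E := by
    rw [hK, invWishartKernel, ← mul_assoc]
    congr 1
    nth_rewrite 1 [← Real.rpow_one E.det]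
    rw [← Real.rpow_add hv.det_pos]
    congr 1; ring
  have hcpos : 0 ≤ (2 * Real.pi) ^ ((r : ℝ) / 2) * A.det ^ (-(1 : ℝ) / 2) := by positivity
  clear_value K
  rw [abs_of_pos hv.det_pos, ← hkern, ENNReal.ofReal_mul hKpos.le,
    ENNReal.ofReal_mul hv.det_pos.le, ENNReal.ofReal_mul hcpos]
  ring

lemma invWishartConst_succ {r : ℕ} (ν : ℝ)
    {S : Matrix (Fin (r + 1)) (Fin (r + 1)) ℝ} {A : Matrix (Fin r) (Fin r) ℝ} (hA : A.PosDef)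
    {w₀ : Fin r → ℝ} {s₀ : ℝ} (hs₀ : 0 < s₀)
    (hS : S.submatrix finSumFinEquiv finSumFinEquiv =
      borderMatrix A (A *ᵥ w₀) (s₀ + w₀ ⬝ᵥ (A *ᵥ w₀))) :
    invWishartConst (ν - 1) A * ((2 * Real.pi) ^ ((r : ℝ) / 2) * A.det ^ (-(1 : ℝ) / 2) *
      ((s₀ / 2) ^ (-(ν / 2)) * Real.Gamma (ν / 2))) = invWishartConst ν S := by
  have hdet : S.det = A.det * s₀ := by
    rw [← det_borderMatrix hA w₀ s₀, ← hS, det_submatrix_equiv_self]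
  have hAp : A.det ^ (-ν / 2) = A.det ^ (-(ν - 1) / 2) * A.det ^ (-(1 : ℝ) / 2) := by
    rw [← Real.rpow_add hA.det_pos]; congr 1; ring
  have h2 : (2 : ℝ) ^ (ν * ((r + 1 : ℕ) : ℝ) / 2) =
      2 ^ ((ν - 1) * (r : ℝ) / 2) * 2 ^ ((r : ℝ) / 2) * 2 ^ (ν / 2) := by
    rw [← Real.rpow_add two_pos, ← Real.rpow_add two_pos]; congr 1; push_cast; ring
  have hs : (s₀ / 2) ^ (-(ν / 2)) = s₀ ^ (-ν / 2) * 2 ^ (ν / 2) := by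
    rw [Real.div_rpow hs₀.le zero_le_two, Real.rpow_neg zero_le_two, div_inv_eq_mul, neg_div]
  have hg : ν / 2 - 1 / 2 = (ν - 1) / 2 := by ring
  rw [invWishartConst, invWishartConst, multivariateGamma_succ, hdet,
    Real.mul_rpow hA.det_pos.le hs₀.le, hAp, h2, hs, Real.mul_rpow zero_le_two Real.pi_pos.le, hg]
  ring

theorem lintegral_invWishartKernel {r : ℕ} {ν : ℝ} (hν : (r : ℝ) - 1 < ν)
    {S : Matrix (Fin r) (Fin r) ℝ} (hS : S.PosDef) :
    ∫⁻ v, Set.indicator {x : LowerIndex r → ℝ | (lowerToSym x).PosDef}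
        (fun x => ENNReal.ofReal (invWishartKernel ν S (lowerToSym x))) v =
      ENNReal.ofReal (invWishartConst ν S) := by
  induction r generalizing ν with
  | zero =>
    have hpd : ∀ v : LowerIndex 0 → ℝ, (lowerToSym v).PosDef := fun v => by
      rw [Subsingleton.elim (lowerToSym v) 1]
      exact PosDef.one
    have hvol : (volume : Measure (LowerIndex 0 → ℝ)) Set.univ = 1 := by
      rw [volume_pi, Measure.pi_univ]
      simp
    simp [hpd, invWishartKernel, invWishartConst, multivariateGamma, Matrix.trace, hvol]
  | succ r ih =>
    have hν' : (r : ℝ) < ν := by push_cast at hν; linarith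
    obtain ⟨A, w₀, s₀, hA, hs₀, hSeq⟩ := hS.exists_eq_borderMatrix
    have hm : Measurable fun x : LowerIndex (r + 1) → ℝ =>
        ENNReal.ofReal (invWishartKernel ν S (lowerToSym x)) :=
      (measurable_invWishartKernel_lowerToSym ν S).ennreal_ofReal
    rw [lintegral_lowerIndex_succ (hm.indicator (measurableSet_posDef _))]
    have hrow : ∀ v : LowerIndex r → ℝ,
        ∫⁻ u, ∫⁻ d, Set.indicator {x : LowerIndex (r + 1) → ℝ | (lowerToSym x).PosDef}
          (fun x => ENNReal.ofReal (invWishartKernel ν S (lowerToSym x))) (joinLower v u d) =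
        Set.indicator {x : LowerIndex r → ℝ | (lowerToSym x).PosDef}
          (fun x => ENNReal.ofReal (invWishartKernel (ν - 1) A (lowerToSym x))) v *
        ENNReal.ofReal ((2 * Real.pi) ^ ((r : ℝ) / 2) * A.det ^ (-(1 : ℝ) / 2) *
          ((s₀ / 2) ^ (-(ν / 2)) * Real.Gamma (ν / 2))) := by
      intro v
      by_cases hv : (lowerToSym v).PosDef
      · rw [Set.indicator_of_mem (show v ∈ {x : LowerIndex r → ℝ | (lowerToSym x).PosDef} from hv),
          lintegral_invWishartKernel_joinLower hν' hA hs₀ hSeq hv]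
      · have hzero : ∀ u d, Set.indicator {x : LowerIndex (r + 1) → ℝ | (lowerToSym x).PosDef}
            (fun x => ENNReal.ofReal (invWishartKernel ν S (lowerToSym x))) (joinLower v u d) = 0 :=
          fun u d => Set.indicator_of_notMem
            (s := {x : LowerIndex (r + 1) → ℝ | (lowerToSym x).PosDef})
            (fun hmem => hv (posDef_of_posDef_joinLower hmem)) _
        rw [Set.indicator_of_notMem (show v ∉ {x : LowerIndex r → ℝ | (lowerToSym x).PosDef} from hv)]
        simp [hzero]
    refine (lintegral_congr hrow).trans ?_
    rw [lintegral_mul_const' _ _ ENNReal.ofReal_ne_top, ih (by linarith) hA,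
      ← ENNReal.ofReal_mul (invWishartConst_pos (by linarith) hA).le,
      invWishartConst_succ ν hA hs₀ hSeq]

/-! ### Moments of the inverse Wishart distribution -/

lemma invWishartKernel_pos {r : ℕ} (ν : ℝ) (S : Matrix (Fin r) (Fin r) ℝ)
    {D : Matrix (Fin r) (Fin r) ℝ} (hD : D.PosDef) : 0 < invWishartKernel ν S D :=
  mul_pos (Real.rpow_pos_of_pos hD.det_pos _) (Real.exp_pos _)

lemma setIntegral_invWishartKernel {r : ℕ} {ν : ℝ} (hν : (r : ℝ) - 1 < ν)
    {S : Matrix (Fin r) (Fin r) ℝ} (hS : S.PosDef) :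
    ∫ v in {x : LowerIndex r → ℝ | (lowerToSym x).PosDef}, invWishartKernel ν S (lowerToSym v) =
      invWishartConst ν S := by
  have h := lintegral_invWishartKernel hν hS
  rw [lintegral_indicator (measurableSet_posDef r)] at h
  rw [integral_eq_lintegral_of_nonneg_ae, h,
    ENNReal.toReal_ofReal (invWishartConst_pos hν hS).le]
  · exact (ae_restrict_iff' (measurableSet_posDef r)).2
      (Filter.Eventually.of_forall fun v hv => (invWishartKernel_pos ν S hv).le)
  · exact (measurable_invWishartKernel_lowerToSym ν S).aestronglyMeasurable

lemma integrableOn_invWishartKernel {r : ℕ} {ν : ℝ} (hν : (r : ℝ) - 1 < ν)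
    {S : Matrix (Fin r) (Fin r) ℝ} (hS : S.PosDef) :
    IntegrableOn (fun v => invWishartKernel ν S (lowerToSym v))
      {x : LowerIndex r → ℝ | (lowerToSym x).PosDef} :=
  Integrable.of_integral_ne_zero <| by
    rw [setIntegral_invWishartKernel hν hS]
    exact (invWishartConst_pos hν hS).ne'

lemma invWishartKernel_mul_exp {r : ℕ} (ν t : ℝ) (S A : Matrix (Fin r) (Fin r) ℝ)
    {D : Matrix (Fin r) (Fin r) ℝ} (hD : D.PosDef) :
    invWishartKernel ν S D *
        Real.exp (t * (-(1 / 2) * Real.log D.det - 1 / 2 * (A * D⁻¹).trace)) =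
      invWishartKernel (ν + t) (S + t • A) D := by
  simp only [invWishartKernel, Real.rpow_def_of_pos hD.det_pos, ← Real.exp_add, Matrix.add_mul,
    trace_add, smul_mul, trace_smul, smul_eq_mul]
  congr 1
  ring

lemma eventually_posDef_add_smul {r : ℕ} {S A : Matrix (Fin r) (Fin r) ℝ} (hS : S.PosDef)
    (hA : A.IsHermitian) : ∀ᶠ t : ℝ in nhds 0, (S + t • A).PosDef := by
  have hcont : Continuous fun z : ℝ × (Fin r → ℝ) => z.2 ⬝ᵥ ((S + z.1 • A) *ᵥ z.2) :=
    continuous_snd.dotProduct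
      ((continuous_const.add (continuous_fst.smul continuous_const)).matrix_mulVec continuous_snd)
  have hsphere : ∀ᶠ t : ℝ in nhds 0, ∀ x ∈ Metric.sphere (0 : Fin r → ℝ) 1,
      0 < x ⬝ᵥ ((S + t • A) *ᵥ x) := by
    refine (isCompact_sphere _ _).eventually_forall_of_forall_eventually fun x hx => ?_
    refine hcont.continuousAt.eventually_const_lt ?_
    have hx0 : x ≠ 0 := by
      rintro rfl
      simp at hx
    simpa using hS.dotProduct_mulVec_pos hx0
  filter_upwards [hsphere] with t ht
  refine .of_dotProduct_mulVec_pos (hS.1.add (hA.smul (IsSelfAdjoint.all t))) fun x hx => ?_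
  have hn : 0 < ‖x‖ := norm_pos_iff.2 hx
  have h := ht (‖x‖⁻¹ • x) (by simp [norm_smul, hn.ne'])
  rw [mulVec_smul, dotProduct_smul, smul_dotProduct, smul_eq_mul, smul_eq_mul] at h
  rw [star_trivial]
  exact pos_of_mul_pos_right (pos_of_mul_pos_right h (by positivity)) (by positivity)

lemma hasDerivAt_det_add_smul {r : ℕ} {S : Matrix (Fin r) (Fin r) ℝ} (hS : S.PosDef)
    (A : Matrix (Fin r) (Fin r) ℝ) :
    HasDerivAt (fun t : ℝ => (S + t • A).det) (S.det * (S⁻¹ * A).trace) 0 := by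
  have hu : IsUnit S.det := hS.det_pos.ne'.isUnit
  have heq : ∀ t : ℝ, (S + t • A).det = S.det * (1 + (S⁻¹ * A).trace * t +
      (det (1 + (Polynomial.X : Polynomial ℝ) • (S⁻¹ * A).map Polynomial.C)).divX.divX.eval t
        * t ^ 2) := by
    intro t
    rw [← det_one_add_smul, ← det_mul, Matrix.mul_add, Matrix.mul_one, Matrix.mul_smul,
      ← Matrix.mul_assoc, mul_nonsing_inv _ hu, Matrix.one_mul]
  simp_rw [heq]
  set q := (det (1 + (Polynomial.X : Polynomial ℝ) • (S⁻¹ * A).map Polynomial.C)).divX.divX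
  have h := ((((hasDerivAt_id (0 : ℝ)).const_mul (S⁻¹ * A).trace).const_add 1).add
    ((q.hasDerivAt 0).mul ((hasDerivAt_id (0 : ℝ)).pow 2))).const_mul S.det
  simpa using h

lemma hasDerivAt_Gamma_digamma {x : ℝ} (hx : 0 < x) :
    HasDerivAt Real.Gamma (Real.Gamma x * digamma x) x := by
  have hd : DifferentiableAt ℝ Real.Gamma x := Real.differentiableAt_Gamma fun m h => by
    have := m.cast_nonneg (α := ℝ)
    linarith
  have hG := (Real.Gamma_pos_of_pos hx).ne'
  have hlog : digamma x = deriv Real.Gamma x / Real.Gamma x := (hd.hasDerivAt.log hG).deriv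
  rw [hlog, mul_div_cancel₀ _ hG]
  exact hd.hasDerivAt

lemma hasDerivAt_multivariateGamma {r : ℕ} {ν : ℝ} (hν : (r : ℝ) - 1 < ν) :
    HasDerivAt (fun t : ℝ => multivariateGamma r ((ν + t) / 2))
      (multivariateGamma r (ν / 2) *
        (1 / 2 * ∑ l ∈ Finset.Icc 1 r, digamma ((ν - (l : ℝ) + 1) / 2))) 0 := by
  have hfac : ∀ l ∈ Finset.Icc 1 r, HasDerivAt
      (fun t : ℝ => Real.Gamma ((ν + t) / 2 + (1 - (l : ℝ)) / 2))
      (Real.Gamma (ν / 2 + (1 - (l : ℝ)) / 2) * (1 / 2 * digamma ((ν - (l : ℝ) + 1) / 2))) 0 := by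
    intro l hl
    have hl' : (l : ℝ) ≤ r := by exact_mod_cast (Finset.mem_Icc.1 hl).2
    have hin : HasDerivAt (fun t : ℝ => (ν + t) / 2 + (1 - (l : ℝ)) / 2) (1 / 2) 0 :=
      (((hasDerivAt_id (0 : ℝ)).const_add ν).div_const 2).add_const _
    have hx : (ν + 0) / 2 + (1 - (l : ℝ)) / 2 = (ν - l + 1) / 2 := by ring
    have hx' : ν / 2 + (1 - (l : ℝ)) / 2 = (ν - l + 1) / 2 := by ring
    have hG : HasDerivAt Real.Gamma _ ((ν + 0) / 2 + (1 - (l : ℝ)) / 2) :=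
      hasDerivAt_Gamma_digamma (by linarith)
    refine (hG.comp (0 : ℝ) hin).congr_deriv ?_
    rw [hx, hx']
    ring
  refine ((HasDerivAt.fun_finsetProd hfac).const_mul _).congr_deriv ?_
  rw [multivariateGamma, mul_assoc]
  congr 1
  rw [Finset.mul_sum, Finset.mul_sum]
  refine Finset.sum_congr rfl fun l hl => ?_
  rw [smul_eq_mul, ← mul_assoc, add_zero, Finset.prod_erase_mul _ _ hl]

lemma hasDerivAt_invWishartConst {r : ℕ} {ν : ℝ} (hν : (r : ℝ) - 1 < ν)
    {S : Matrix (Fin r) (Fin r) ℝ} (hS : S.PosDef) (A : Matrix (Fin r) (Fin r) ℝ) :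
    HasDerivAt (fun t : ℝ => invWishartConst (ν + t) (S + t • A))
      (invWishartConst ν S * (-(1 / 2) * Real.log S.det - ν / 2 * (S⁻¹ * A).trace +
        (r : ℝ) / 2 * Real.log 2 +
        1 / 2 * ∑ l ∈ Finset.Icc 1 r, digamma ((ν - (l : ℝ) + 1) / 2))) 0 := by
  have hexp : HasDerivAt (fun t : ℝ => -(ν + t) / 2) (-1 / 2) 0 :=
    ((hasDerivAt_id (0 : ℝ)).const_add ν).neg.div_const 2
  have hdet0 : (0 : ℝ) < (S + (0 : ℝ) • A).det := by simpa using hS.det_pos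
  have h1 := (hasDerivAt_det_add_smul hS A).rpow hexp hdet0
  have hexp2 : HasDerivAt (fun t : ℝ => (ν + t) * (r : ℝ) / 2) ((r : ℝ) / 2) 0 := by
    simpa using (((hasDerivAt_id (0 : ℝ)).const_add ν).mul_const (r : ℝ)).div_const 2
  have h2 := hexp2.const_rpow (two_pos : (0 : ℝ) < 2)
  refine ((h1.fun_mul h2).fun_mul (hasDerivAt_multivariateGamma hν)).congr_deriv ?_
  have hpow : S.det ^ (-ν / 2 - 1) * S.det = S.det ^ (-ν / 2) := by
    rw [← Real.rpow_add_one hS.det_pos.ne']; congr 1; ring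
  simp only [invWishartConst, zero_smul, add_zero, ← hpow]
  ring

/-- The mean of `-(1/2) log det D - (1/2) tr(A D⁻¹)` under the inverse Wishart kernel. -/
lemma integral_invWishartKernel_mul {r : ℕ} {ν : ℝ} (hν : (r : ℝ) - 1 < ν)
    {S A : Matrix (Fin r) (Fin r) ℝ} (hS : S.PosDef) (hA : A.IsHermitian) :
    IntegrableOn (fun v => invWishartKernel ν S (lowerToSym v) *
        (-(1 / 2) * Real.log (lowerToSym v).det - 1 / 2 * (A * (lowerToSym v)⁻¹).trace))
      {x : LowerIndex r → ℝ | (lowerToSym x).PosDef} ∧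
    ∫ v in {x : LowerIndex r → ℝ | (lowerToSym x).PosDef}, invWishartKernel ν S (lowerToSym v) *
        (-(1 / 2) * Real.log (lowerToSym v).det - 1 / 2 * (A * (lowerToSym v)⁻¹).trace) =
      invWishartConst ν S * (-(1 / 2) * Real.log S.det - ν / 2 * (S⁻¹ * A).trace +
        (r : ℝ) / 2 * Real.log 2 +
        1 / 2 * ∑ l ∈ Finset.Icc 1 r, digamma ((ν - (l : ℝ) + 1) / 2)) := by
  set P := {x : LowerIndex r → ℝ | (lowerToSym x).PosDef} with hP
  have hPm : MeasurableSet P := measurableSet_posDef r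
  set X : (LowerIndex r → ℝ) → ℝ := fun v =>
    -(1 / 2) * Real.log (lowerToSym v).det - 1 / 2 * (A * (lowerToSym v)⁻¹).trace with hX
  set f : (LowerIndex r → ℝ) → ENNReal := fun v =>
    ENNReal.ofReal (invWishartKernel ν S (lowerToSym v)) with hf
  have hfm : Measurable f := (measurable_invWishartKernel_lowerToSym ν S).ennreal_ofReal
  have hftop : ∀ᵐ v ∂(volume.restrict P), f v < ⊤ :=
    Filter.Eventually.of_forall fun _ => ENNReal.ofReal_lt_top
  set m := (volume.restrict P).withDensity f with hm
  have hae : ∀ g : (LowerIndex r → ℝ) → ℝ, (fun v => (f v).toReal • g v) =ᵐ[volume.restrict P]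
      fun v => invWishartKernel ν S (lowerToSym v) * g v := fun g =>
    (ae_restrict_iff' hPm).2 (Filter.Eventually.of_forall fun v hv => by
      simp only [hf, ENNReal.toReal_ofReal (invWishartKernel_pos ν S hv).le, smul_eq_mul])
  have hintble : ∀ g : (LowerIndex r → ℝ) → ℝ, Integrable g m ↔
      IntegrableOn (fun v => invWishartKernel ν S (lowerToSym v) * g v) P := fun g => by
    rw [hm, integrable_withDensity_iff_integrable_smul' hfm hftop, integrable_congr (hae g),
      IntegrableOn]
  have hintegral : ∀ g : (LowerIndex r → ℝ) → ℝ, ∫ v, g v ∂m =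
      ∫ v in P, invWishartKernel ν S (lowerToSym v) * g v := fun g => by
    rw [hm, integral_withDensity_eq_integral_toReal_smul hfm hftop, integral_congr_ae (hae g)]
  have hshift : ∀ t : ℝ, Set.EqOn
      (fun v => invWishartKernel ν S (lowerToSym v) * Real.exp (t * X v))
      (fun v => invWishartKernel (ν + t) (S + t • A) (lowerToSym v)) P := fun t v hv =>
    invWishartKernel_mul_exp ν t S A hv
  have hgood : ∀ᶠ t : ℝ in nhds 0, (S + t • A).PosDef ∧ (r : ℝ) - 1 < ν + t :=
    (eventually_posDef_add_smul hS hA).and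
      ((continuous_const.add continuous_id).continuousAt.eventually_const_lt (by simpa using hν))
  have hmem : (0 : ℝ) ∈ interior (ProbabilityTheory.integrableExpSet X m) := by
    rw [mem_interior_iff_mem_nhds]
    filter_upwards [hgood] with t ht
    exact (hintble _).2 ((integrableOn_congr_fun (hshift t) hPm).2
      (integrableOn_invWishartKernel ht.2 ht.1))
  have hmgf : ProbabilityTheory.mgf X m =ᶠ[nhds 0]
      fun t : ℝ => invWishartConst (ν + t) (S + t • A) := by
    filter_upwards [hgood] with t ht
    rw [ProbabilityTheory.mgf, hintegral, setIntegral_congr_fun hPm (hshift t),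
      setIntegral_invWishartKernel ht.2 ht.1]
  refine ⟨(hintble X).1 (ProbabilityTheory.integrable_of_mem_interior_integrableExpSet hmem), ?_⟩
  rw [← hintegral X, ← ProbabilityTheory.deriv_mgf_zero hmem, hmgf.deriv_eq,
    (hasDerivAt_invWishartConst hν hS A).deriv]

/-! ### Integrating the Gaussian log-density -/

lemma log_gaussDensity {r : ℕ} {D : Matrix (Fin r) (Fin r) ℝ} (hD : D.PosDef)
    (m a : Fin r → ℝ) :
    Real.log (gaussDensity m D a) =
      (-((r : ℝ) / 2) * Real.log (2 * Real.pi) - 1 / 2 * Real.log D.det) +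
        (a - m) ⬝ᵥ ((-(1 / 2 : ℝ) • D⁻¹) *ᵥ (a - m)) := by
  have h2pi : (0 : ℝ) < 2 * Real.pi := by positivity
  have hdet := Real.rpow_pos_of_pos hD.det_pos (-(1 : ℝ) / 2)
  rw [gaussDensity, Real.log_mul (mul_pos (by positivity) hdet).ne' (Real.exp_pos _).ne',
    Real.log_mul (by positivity) hdet.ne', Real.log_rpow h2pi, Real.log_rpow hD.det_pos,
    Real.log_exp, smul_mulVec, dotProduct_smul, smul_eq_mul]
  ring

lemma trace_vecMulVec_self_mul {r : ℕ} (y : Fin r → ℝ) (M : Matrix (Fin r) (Fin r) ℝ) :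
    (M * vecMulVec y y).trace = y ⬝ᵥ (M *ᵥ y) := by
  rw [mul_vecMulVec, trace_vecMulVec, dotProduct_comm]

lemma integral_gaussDensity_log_gaussDensity {p r : ℕ} (μβ : Fin p → ℝ) (μα : Fin r → ℝ)
    {Cβ : Matrix (Fin p) (Fin p) ℝ} {Cα : Matrix (Fin r) (Fin r) ℝ}
    (hCβ : Cβ.PosDef) (hCα : Cα.PosDef) (Wt : Matrix (Fin r) (Fin p) ℝ) (k : ℝ)
    {D : Matrix (Fin r) (Fin r) ℝ} (hD : D.PosDef) :
    ∫ a : Fin r → ℝ, ∫ b : Fin p → ℝ, gaussDensity μβ Cβ b * gaussDensity μα Cα a * k *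
        Real.log (gaussDensity (Wt *ᵥ b) D a) =
      k * (-((r : ℝ) / 2) * Real.log (2 * Real.pi) + (-(1 / 2) * Real.log D.det -
        1 / 2 * ((vecMulVec (μα - Wt *ᵥ μβ) (μα - Wt *ᵥ μβ) + (Cα + Wt * Cβ * Wtᵀ)) *
          D⁻¹).trace)) := by
  set Q := -(1 / 2 : ℝ) • D⁻¹ with hQ
  set c := -((r : ℝ) / 2) * Real.log (2 * Real.pi) - 1 / 2 * Real.log D.det with hc
  have hinner : ∀ a : Fin r → ℝ, ∫ b : Fin p → ℝ, gaussDensity μβ Cβ b * gaussDensity μα Cα a *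
      k * Real.log (gaussDensity (Wt *ᵥ b) D a) =
      k * (gaussDensity μα Cα a * ((c + (Q * (Wt * Cβ * Wtᵀ)).trace) +
        (Wt *ᵥ μβ - 1 *ᵥ a) ⬝ᵥ (Q *ᵥ (Wt *ᵥ μβ - 1 *ᵥ a)))) := by
    intro a
    have hb : ∀ b, gaussDensity μβ Cβ b * gaussDensity μα Cα a * k *
        Real.log (gaussDensity (Wt *ᵥ b) D a) = (k * gaussDensity μα Cα a) *
          (gaussDensity μβ Cβ b * (c + (a - Wt *ᵥ b) ⬝ᵥ (Q *ᵥ (a - Wt *ᵥ b)))) := fun b => by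
      rw [log_gaussDensity hD]
      ring
    simp_rw [hb]
    rw [integral_const_mul, integral_gaussDensity_mul_quadratic μβ hCβ, one_mulVec,
      ← neg_sub a, mulVec_neg, neg_dotProduct_neg]
    ring
  simp_rw [hinner]
  rw [integral_const_mul, integral_gaussDensity_mul_quadratic μα hCα, one_mulVec,
    ← neg_sub μα, mulVec_neg, neg_dotProduct_neg, Matrix.one_mul, transpose_one, Matrix.mul_one,
    trace_mul_comm _ D⁻¹, Matrix.mul_add, Matrix.mul_add, trace_add, trace_add,
    trace_vecMulVec_self_mul]
  simp only [hQ, hc, smul_mul, trace_smul, smul_mulVec, dotProduct_smul, smul_eq_mul]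
  ring

lemma invWishartDensity_eq {r : ℕ} (ν : ℝ) {S : Matrix (Fin r) (Fin r) ℝ} (hS : S.PosDef)
    (D : Matrix (Fin r) (Fin r) ℝ) :
    invWishartDensity r ν S D = (invWishartConst ν S)⁻¹ * invWishartKernel ν S D := by
  have h1 : S.det ^ (ν / 2) = (S.det ^ (-ν / 2))⁻¹ := by
    rw [neg_div, Real.rpow_neg hS.det_pos.le, inv_inv]
  have h2 : (2 : ℝ) ^ (-(ν * (r : ℝ)) / 2) = ((2 : ℝ) ^ (ν * (r : ℝ) / 2))⁻¹ := by
    rw [neg_div, Real.rpow_neg zero_le_two]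
  rw [invWishartDensity, invWishartConst, invWishartKernel, h1, h2, mul_inv, mul_inv]
  ring

/-- **Closed form of the term `S_{α̃_i} = E_q{log p(α̃_i | β, D)}` in the variational lower
bound for the GLMM**, where `q(β)`, `q(α̃_i)` are Gaussian, `q(D)` is inverse Wishart, all
mutually independent, and `α̃_i | β, D ∼ N(W̃β, D)`. -/
theorem expected_log_randomEffect_density {p r : ℕ} (hp : 1 ≤ p) (hr : 1 ≤ r)
    (μβ : Fin p → ℝ) (μα : Fin r → ℝ)
    (Cβ : Matrix (Fin p) (Fin p) ℝ) (Cα : Matrix (Fin r) (Fin r) ℝ)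
    (hCβ : Cβ.PosDef) (hCα : Cα.PosDef)
    (Wt : Matrix (Fin r) (Fin p) ℝ)
    (ν : ℝ) (hν : (r : ℝ) - 1 < ν)
    (S : Matrix (Fin r) (Fin r) ℝ) (hS : S.PosDef) :
    spdIntegral r (fun D =>
        ∫ a : Fin r → ℝ, ∫ b : Fin p → ℝ,
          gaussDensity μβ Cβ b * gaussDensity μα Cα a * invWishartDensity r ν S D *
            Real.log (gaussDensity (Wt *ᵥ b) D a)) =
      -((r : ℝ) / 2) * Real.log (2 * Real.pi)
        - (1 / 2) * (Real.log S.det - (∑ l ∈ Finset.Icc 1 r, digamma ((ν - (l : ℝ) + 1) / 2))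
            - (r : ℝ) * Real.log 2)
        - (ν / 2) * ((μα - Wt *ᵥ μβ) ⬝ᵥ (S⁻¹ *ᵥ (μα - Wt *ᵥ μβ))
            + (S⁻¹ * (Cα + Wt * Cβ * Wtᵀ)).trace) := by
  set y := μα - Wt *ᵥ μβ
  set A := vecMulVec y y + (Cα + Wt * Cβ * Wtᵀ) with hA
  have hAherm : A.IsHermitian := by
    have hWC : (Wt * Cβ * Wtᵀ).IsHermitian := by
      rw [← conjTranspose_eq_transpose_of_trivial]
      exact isHermitian_mul_mul_conjTranspose _ hCβ.1
    have hyy : (vecMulVec y y).IsHermitian := by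
      rw [IsHermitian, conjTranspose_vecMulVec, star_trivial]
    exact hyy.add (hCα.1.add hWC)
  obtain ⟨hintble, hval⟩ := integral_invWishartKernel_mul hν hS hAherm
  have hPm := measurableSet_posDef r
  have hcongr : Set.EqOn (fun v : LowerIndex r → ℝ =>
      ∫ a : Fin r → ℝ, ∫ b : Fin p → ℝ,
        gaussDensity μβ Cβ b * gaussDensity μα Cα a * invWishartDensity r ν S (lowerToSym v) *
          Real.log (gaussDensity (Wt *ᵥ b) (lowerToSym v) a))
      (fun v => (invWishartConst ν S)⁻¹ * (invWishartKernel ν S (lowerToSym v) *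
        (-((r : ℝ) / 2) * Real.log (2 * Real.pi)) + invWishartKernel ν S (lowerToSym v) *
        (-(1 / 2) * Real.log (lowerToSym v).det - 1 / 2 * (A * (lowerToSym v)⁻¹).trace)))
      {x : LowerIndex r → ℝ | (lowerToSym x).PosDef} := by
    intro v hv
    have hD : (lowerToSym v).PosDef := hv
    simp only
    rw [integral_gaussDensity_log_gaussDensity μβ μα hCβ hCα Wt _ hD, invWishartDensity_eq ν hS]
    ring
  rw [spdIntegral, integral_indicator hPm, setIntegral_congr_fun hPm hcongr, integral_const_mul,
    integral_add ((integrableOn_invWishartKernel hν hS).mul_const _) hintble, integral_mul_const,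
    setIntegral_invWishartKernel hν hS, hval, ← mul_add,
    inv_mul_cancel_left₀ (invWishartConst_pos hν hS).ne', hA, Matrix.mul_add, trace_add,
    trace_vecMulVec_self_mul]
  ring
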